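/- Let n ≥ 1, let B ∈ M_n(ℂ) be positive definite with Tr B = 1, and set τ(a) = Tr(aB), a faithful state on M_n(ℂ). On M_n(ℂ) ⊗ N_ν (Kronecker tensor product, with product state z ↦ Tr(z (B ⊗ A_ν))) define the left norm ‖z‖_♯ = ‖z (B ⊗ A_ν)‖_{C_1}. Let r_0, r_1, r_2, r_3 ∈ M_2(ℂ) satisfy ρ_1(r_j* r_k) = δ_{jk}, let h^{(ν)} be the left Haar system, and define the projections H^{(ν)}_j z = (1_n ⊗ h^{(ν)}_j) · E((1_n ⊗ h^{(ν)}_j)* z), where E : M_n(ℂ) ⊗ N_ν → M_n(ℂ) ⊗ 1 is the linear map determined by E(a ⊗ b) = ρ_ν(b)·(a ⊗ 1). Then the minimal constant c_ν such that ‖Σ_{j=0}^{m} H^{(ν)}_j z‖_♯ ≤ c_ν · ‖Σ_{j=0}^{4^ν−1} H^{(ν)}_j z‖_♯ for all z ∈ M_n(ℂ) ⊗ N_ν and all 0 ≤ m < 4^ν satisfies c_1 ≤ Σ_{j=0}^{3} ‖r_j‖·‖r_j‖_♯ and c_{ν+1} ≤ max{ c_ν ‖r_0‖², ‖r_0‖²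 + 2(‖r_1‖² + ‖r_2‖² + ‖r_3‖²) }. -/

import Mathlib

open Finset
open scoped ENNReal ComplexOrder Kronecker Matrix

noncomputable section

/-- Kronecker product of square complex matrices, realized on `Fin (m * n)`. -/
def kron {m n : ℕ} (x : Matrix (Fin m) (Fin m) ℂ) (y : Matrix (Fin n) (Fin n) ℂ) :
    Matrix (Fin (m * n)) (Fin (m * n)) ℂ :=
  Matrix.reindex finProdFinEquiv finProdFinEquiv (x ⊗ₖ y)

/-- The matrix `A₁ = diag(α, 1 - α)`. -/
def A1 (α : ℝ) : Matrix (Fin 2) (Fin 2) ℂ :=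
  Matrix.diagonal ![(α : ℂ), ((1 - α : ℝ) : ℂ)]

/-- The matrix `A₁^t = diag(α^t, (1 - α)^t)` (entrywise real power on the diagonal). -/
def A1t (α t : ℝ) : Matrix (Fin 2) (Fin 2) ℂ :=
  Matrix.diagonal ![((α ^ t : ℝ) : ℂ), (((1 - α) ^ t : ℝ) : ℂ)]

/-- `Amat α ν = A_ν`, the ν-fold Kronecker power of `diag(α, 1-α)`. -/
def Amat (α : ℝ) : (ν : ℕ) → Matrix (Fin (2 ^ ν)) (Fin (2 ^ ν)) ℂ
  | 0 => 1
  | ν + 1 => kron (Amat α ν) (A1 α)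

/-- `Amatt α t ν = A_ν^t`, the ν-fold Kronecker power of `diag(α^t, (1-α)^t)`. -/
def Amatt (α t : ℝ) : (ν : ℕ) → Matrix (Fin (2 ^ ν)) (Fin (2 ^ ν)) ℂ
  | 0 => 1
  | ν + 1 => kron (Amatt α t ν) (A1t α t)

/-- The state `ρ_ν(x) = Tr (x A_ν)` on `N_ν = M_{2^ν}(ℂ)`. -/
def rho (α : ℝ) (ν : ℕ) (x : Matrix (Fin (2 ^ ν)) (Fin (2 ^ ν)) ℂ) : ℂ :=
  (x * Amat α ν).trace

/-- The state `ρ_1(x) = Tr (x A_1)` on `M_2(ℂ)`. -/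
def rho1 (α : ℝ) (x : Matrix (Fin 2) (Fin 2) ℂ) : ℂ :=
  (x * A1 α).trace

/-- The Schatten `p`-norm `‖x‖_{C_p} = (Tr ((x^* x)^{p/2}))^{1/p}`, `1 ≤ p < ∞`,
computed through the eigenvalues of the positive semidefinite matrix `x^* x`. -/
def schatten {N : ℕ} (p : ℝ) (x : Matrix (Fin N) (Fin N) ℂ) : ℝ :=
  (∑ i, ((Matrix.posSemidef_conjTranspose_mul_self x).isHermitian.eigenvalues i) ^ (p / 2)) ^
    (1 / p)

/-- The operator norm `‖x‖ = ‖x‖_{C_∞}` of a complex matrix (acting on ℓ²). -/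
def opNorm {N : ℕ} (x : Matrix (Fin N) (Fin N) ℂ) : ℝ :=
  ‖Matrix.toEuclideanCLM (𝕜 := ℂ) x‖

/-- The left predual norm `‖x‖_♯ = ‖x A_ν‖_{C_1}` on `N_ν`. -/
def sharpNorm (α : ℝ) {ν : ℕ} (x : Matrix (Fin (2 ^ ν)) (Fin (2 ^ ν)) ℂ) : ℝ :=
  schatten 1 (x * Amat α ν)

/-- The right predual norm `‖x‖_♭ = ‖A_ν x‖_{C_1}` on `N_ν`. -/
def flatNorm (α : ℝ) {ν : ℕ} (x : Matrix (Fin (2 ^ ν)) (Fin (2 ^ ν)) ℂ) : ℝ :=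
  schatten 1 (Amat α ν * x)

/-- The left predual norm `‖x‖_♯ = ‖x A_1‖_{C_1}` on `M_2(ℂ)`. -/
def sharp2 (α : ℝ) (x : Matrix (Fin 2) (Fin 2) ℂ) : ℝ :=
  schatten 1 (x * A1 α)

/-- The right predual norm `‖x‖_♭ = ‖A_1 x‖_{C_1}` on `M_2(ℂ)`. -/
def flat2 (α : ℝ) (x : Matrix (Fin 2) (Fin 2) ℂ) : ℝ :=
  schatten 1 (A1 α * x)

/-- The left norm `‖x‖_{p,♯} = ‖x A_ν^{1/p}‖_{C_p}` on `N_ν`, `1 ≤ p ≤ ∞`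
(for `p = ∞` it is the operator norm). -/
def lpSharp (α : ℝ) (p : ℝ≥0∞) {ν : ℕ} (x : Matrix (Fin (2 ^ ν)) (Fin (2 ^ ν)) ℂ) : ℝ :=
  if p = ∞ then opNorm x else schatten p.toReal (x * Amatt α (1 / p.toReal) ν)

/-- The right norm `‖x‖_{p,♭} = ‖A_ν^{1/p} x‖_{C_p}` on `N_ν`, `1 ≤ p ≤ ∞`. -/
def lpFlat (α : ℝ) (p : ℝ≥0∞) {ν : ℕ} (x : Matrix (Fin (2 ^ ν)) (Fin (2 ^ ν)) ℂ) : ℝ :=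
  if p = ∞ then opNorm x else schatten p.toReal (Amatt α (1 / p.toReal) ν * x)

/-- The left norm `‖x‖_{p,♯} = ‖x A_1^{1/p}‖_{C_p}` on `M_2(ℂ)`. -/
def lp2Sharp (α : ℝ) (p : ℝ≥0∞) (x : Matrix (Fin 2) (Fin 2) ℂ) : ℝ :=
  if p = ∞ then opNorm x else schatten p.toReal (x * A1t α (1 / p.toReal))

/-- `shellNum r c` is `s(r+1, c+1) - 1`, the zero-based shell enumeration index of the
matrix unit `E_{r c}` (zero-based indices `r`, `c`): `s(r,c) = (c-1)² + r` if `r ≤ c`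
and `s(r,c) = r² - c + 1` if `r > c` (one-based). -/
def shellNum (r c : ℕ) : ℕ :=
  if r ≤ c then c * c + r else r * r + 2 * r - c

/-- `eUnit N m` is the `m`-th matrix unit `e_m` of `M_N(ℂ)` in the shell enumeration:
`e_{s(r,c) - 1} = E_{r c}`. -/
def eUnit (N m : ℕ) : Matrix (Fin N) (Fin N) ℂ :=
  Matrix.of fun r c => if shellNum (r : ℕ) (c : ℕ) = m then 1 else 0

/-- The left Haar system `h^{(ν)}_j` in `N_ν` built from `r_0, r_1, r_2, r_3 ∈ M_2(ℂ)`: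
`h^{(1)}_j = r_j`, and for `j = 4^ν q + k` (`0 ≤ q ≤ 3`, `0 ≤ k < 4^ν`),
`h^{(ν+1)}_j = h^{(ν)}_k ⊗ r_0` if `q = 0` and `h^{(ν+1)}_j = e^{(ν)}_k ⊗ r_q` if `q ≠ 0`. -/
def haar (r : ℕ → Matrix (Fin 2) (Fin 2) ℂ) :
    (ν : ℕ) → ℕ → Matrix (Fin (2 ^ ν)) (Fin (2 ^ ν)) ℂ
  | 0, _ => 1
  | 1, j => r (j % 4)
  | ν + 2, j =>
      if j / 4 ^ (ν + 1) = 0 then kron (haar r (ν + 1) j) (r 0)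
      else kron (eUnit (2 ^ (ν + 1)) (j % 4 ^ (ν + 1))) (r (j / 4 ^ (ν + 1) % 4))


/-- The projection `H^{(ν)}_j z = (1_n ⊗ h^{(ν)}_j) · E((1_n ⊗ h^{(ν)}_j)^* z)` on
`M_n(ℂ) ⊗ N_ν`, associated with the left Haar system and the conditional expectation `E`. -/
def Hproj (α : ℝ) {n ν : ℕ} (r : ℕ → Matrix (Fin 2) (Fin 2) ℂ)
    (E : Matrix (Fin (n * 2 ^ ν)) (Fin (n * 2 ^ ν)) ℂ →ₗ[ℂ]
      Matrix (Fin (n * 2 ^ ν)) (Fin (n * 2 ^ ν)) ℂ)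
    (j : ℕ) (z : Matrix (Fin (n * 2 ^ ν)) (Fin (n * 2 ^ ν)) ℂ) :
    Matrix (Fin (n * 2 ^ ν)) (Fin (n * 2 ^ ν)) ℂ :=
  kron (1 : Matrix (Fin n) (Fin n) ℂ) (haar r ν j) *
    E ((kron (1 : Matrix (Fin n) (Fin n) ℂ) (haar r ν j))ᴴ * z)

section Helpers

open scoped Matrix.Norms.L2Operator

set_option linter.unusedSectionVars false

variable {ι κ : Type} [Fintype ι] [DecidableEq ι] [Fintype κ] [DecidableEq κ]

/-- Trace norm on a general finite index type. -/
def tn (x : Matrix ι ι ℂ) : ℝ :=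
  ∑ i, Real.sqrt ((Matrix.posSemidef_conjTranspose_mul_self x).isHermitian.eigenvalues i)

lemma schatten_one_eq_tn {N : ℕ} (x : Matrix (Fin N) (Fin N) ℂ) : schatten 1 x = tn x := by
  simp [schatten, tn, Real.sqrt_eq_rpow]

lemma opNorm_eq {N : ℕ} (x : Matrix (Fin N) (Fin N) ℂ) : opNorm x = ‖x‖ := rfl

lemma tn_nonneg (x : Matrix ι ι ℂ) : 0 ≤ tn x :=
  Finset.sum_nonneg fun _ _ => Real.sqrt_nonneg _

/-- Polar decomposition. -/
lemma tn_polar (x : Matrix ι ι ℂ) : ∃ X P : Matrix ι ι ℂ, P.PosSemidef ∧ ‖X‖ ≤ 1 ∧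
    x = X * P ∧ Xᴴ * x = P ∧ P.trace = (tn x : ℂ) := by
  set hP := Matrix.posSemidef_conjTranspose_mul_self x
  set hH := hP.isHermitian
  set l := hH.eigenvalues with hl
  have hl0 : ∀ i, 0 ≤ l i := hP.eigenvalues_nonneg
  let U : Matrix ι ι ℂ := (hH.eigenvectorUnitary : Matrix ι ι ℂ)
  have hUU : Uᴴ * U = 1 := Unitary.coe_star_mul_self hH.eigenvectorUnitary
  have hUU' : U * Uᴴ = 1 := Unitary.coe_mul_star_self hH.eigenvectorUnitary
  have hUn : ‖U‖ ≤ 1 := by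
    have h := Matrix.l2_opNorm_conjTranspose_mul_self U
    rw [hUU] at h
    have h1 : ‖(1 : Matrix ι ι ℂ)‖ ≤ 1 := by
      rw [← Matrix.diagonal_one, Matrix.l2_opNorm_diagonal]
      exact (pi_norm_le_iff_of_nonneg zero_le_one).2 (by simp)
    nlinarith [norm_nonneg U]
  have hspec : xᴴ * x = U * Matrix.diagonal (fun i => (l i : ℂ)) * Uᴴ := by
    have := hH.spectral_theorem
    rw [Unitary.conjStarAlgAut_apply] at this
    exact this
  have key : ∀ f g : ι → ℂ, (U * Matrix.diagonal f * Uᴴ) * (U * Matrix.diagonal g * Uᴴ)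
      = U * Matrix.diagonal (fun i => f i * g i) * Uᴴ := by
    intro f g
    calc _ = U * Matrix.diagonal f * (Uᴴ * U) * Matrix.diagonal g * Uᴴ := by
          simp only [Matrix.mul_assoc]
      _ = _ := by
          rw [hUU, Matrix.mul_one, Matrix.mul_assoc U, Matrix.diagonal_mul_diagonal]
  have keyH : ∀ f : ι → ℝ, (U * Matrix.diagonal (fun i => (f i : ℂ)) * Uᴴ)ᴴ
      = U * Matrix.diagonal (fun i => (f i : ℂ)) * Uᴴ := by
    intro f
    simp only [Matrix.conjTranspose_mul, Matrix.conjTranspose_conjTranspose,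
      Matrix.diagonal_conjTranspose, Matrix.mul_assoc]
    congr 3
    ext i
    simp
  let s : ι → ℝ := fun i => (Real.sqrt (l i))⁻¹
  let D : (ι → ℝ) → Matrix ι ι ℂ := fun f => U * Matrix.diagonal (fun i => (f i : ℂ)) * Uᴴ
  have hD : ∀ f g, D f * D g = D (fun i => f i * g i) := by
    intro f g
    simp only [D, key, Complex.ofReal_mul]
  have hDH : ∀ f, (D f)ᴴ = D f := keyH
  have hxx : xᴴ * x = D l := hspec
  have hD1 : D (fun _ => 1) = 1 := by simp [D, hUU']
  have hDsub : ∀ f g, D f - D g = D (fun i => f i - g i) := by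
    intro f g
    simp only [D, ← Matrix.sub_mul, ← Matrix.mul_sub, Matrix.diagonal_sub, Complex.ofReal_sub]
  have hDn : ∀ f, (∀ i, |f i| ≤ 1) → ‖D f‖ ≤ 1 := by
    intro f hf
    have h2 : ‖Matrix.diagonal (fun i => (f i : ℂ))‖ ≤ 1 := by
      rw [Matrix.l2_opNorm_diagonal]
      exact (pi_norm_le_iff_of_nonneg zero_le_one).2 (by simpa using hf)
    have h3 := Matrix.l2_opNorm_mul (U * Matrix.diagonal (fun i => (f i : ℂ))) Uᴴ
    have h4 := Matrix.l2_opNorm_mul U (Matrix.diagonal (fun i => (f i : ℂ)))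
    rw [Matrix.l2_opNorm_conjTranspose] at h3
    calc _ ≤ _ := h3
      _ ≤ (1 * 1) * 1 := by gcongr; exact h4.trans (by gcongr)
      _ = 1 := by norm_num
  have hsl : ∀ i, s i * l i = Real.sqrt (l i) := by
    intro i
    simp only [s]
    rcases eq_or_lt_of_le (hl0 i) with h | h
    · simp [← h]
    · have := Real.sqrt_pos.2 h
      field_simp
      rw [Real.sq_sqrt h.le]
  refine ⟨x * D s, D (fun i => Real.sqrt (l i)), ?_, ?_, ?_, ?_, ?_⟩
  · refine Matrix.PosSemidef.mul_mul_conjTranspose_same ?_ U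
    refine Matrix.PosSemidef.diagonal ?_
    intro i
    simp [Real.sqrt_nonneg]
  · have h := Matrix.l2_opNorm_conjTranspose_mul_self (x * D s)
    have : (x * D s)ᴴ * (x * D s) = D (fun i => s i * (l i * s i)) := by
      rw [Matrix.conjTranspose_mul, hDH, Matrix.mul_assoc, ← Matrix.mul_assoc xᴴ, hxx, hD, hD]
    rw [this] at h
    have h1 := hDn (fun i => s i * (l i * s i)) (by
      intro i
      rw [← mul_assoc, hsl]
      simp only [s]
      by_cases h0 : Real.sqrt (l i) = 0
      · simp [h0]
      · rw [mul_inv_cancel₀ h0]; simp)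
    nlinarith [norm_nonneg (x * D s)]
  · rw [Matrix.mul_assoc, hD, ← sub_eq_zero]
    have e : x - x * D (fun i => s i * √(l i)) = x * D (fun i => 1 - s i * √(l i)) := by
      rw [← hDsub, hD1, Matrix.mul_sub, Matrix.mul_one]
    rw [e, ← Matrix.conjTranspose_mul_self_eq_zero, Matrix.conjTranspose_mul, hDH,
      Matrix.mul_assoc, ← Matrix.mul_assoc xᴴ, hxx, hD, hD]
    have : (fun i => (1 - s i * √(l i)) * (l i * (1 - s i * √(l i)))) = fun _ => 0 := by
      ext i
      by_cases h0 : Real.sqrt (l i) = 0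
      · rw [Real.sqrt_eq_zero (hl0 i)] at h0
        simp [h0]
      · simp only [s]; rw [inv_mul_cancel₀ h0]; simp
    rw [this]
    simp [D]
  · rw [Matrix.conjTranspose_mul, hDH, Matrix.mul_assoc, hxx, hD]
    simp only [hsl]
  · simp only [D]
    rw [Matrix.trace_mul_comm, ← Matrix.mul_assoc, hUU, Matrix.one_mul, Matrix.trace_diagonal]
    simp [tn, l]

lemma norm_entry_le (u : Matrix ι ι ℂ) (i j : ι) : ‖u i j‖ ≤ ‖u‖ := by
  have h := Matrix.l2_opNorm_mulVec u (WithLp.toLp 2 (Pi.single j 1))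
  have h2 := PiLp.norm_apply_le ((EuclideanSpace.equiv ι ℂ).symm <| u *ᵥ
    (WithLp.toLp 2 (Pi.single j (1:ℂ)) : EuclideanSpace ℂ ι)) i
  have h3 : ‖(WithLp.toLp 2 (Pi.single j (1:ℂ)) : EuclideanSpace ℂ ι)‖ = 1 := by simp
  rw [h3, mul_one] at h
  refine le_trans (le_of_eq ?_) (h2.trans h)
  simp

lemma norm_trace_mul_posSemidef_le (u P : Matrix ι ι ℂ) (hP : P.PosSemidef) :
    ‖(u * P).trace‖ ≤ ‖u‖ * P.trace.re := by
  set hH := hP.isHermitian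
  set l := hH.eigenvalues with hl
  have hl0 : ∀ i, 0 ≤ l i := hP.eigenvalues_nonneg
  let U : Matrix ι ι ℂ := (hH.eigenvectorUnitary : Matrix ι ι ℂ)
  have hUU : Uᴴ * U = 1 := Unitary.coe_star_mul_self hH.eigenvectorUnitary
  have hUn : ‖U‖ ≤ 1 := by
    have h := Matrix.l2_opNorm_conjTranspose_mul_self U
    rw [hUU] at h
    have h1 : ‖(1 : Matrix ι ι ℂ)‖ ≤ 1 := by
      rw [← Matrix.diagonal_one, Matrix.l2_opNorm_diagonal]
      exact (pi_norm_le_iff_of_nonneg zero_le_one).2 (by simp)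
    nlinarith [norm_nonneg U]
  have hspec : P = U * Matrix.diagonal (fun i => (l i : ℂ)) * Uᴴ := by
    have := hH.spectral_theorem
    rw [Unitary.conjStarAlgAut_apply] at this
    exact this
  have ht : P.trace.re = ∑ i, l i := by
    rw [hspec, Matrix.trace_mul_comm, ← Matrix.mul_assoc, hUU, Matrix.one_mul,
      Matrix.trace_diagonal]
    simp
  have ht2 : (u * P).trace = ∑ i, (Uᴴ * u * U) i i * (l i : ℂ) := by
    conv_lhs => rw [hspec]
    rw [← Matrix.mul_assoc, Matrix.trace_mul_comm, ← Matrix.mul_assoc, ← Matrix.mul_assoc,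
      Matrix.trace]
    simp [Matrix.mul_diagonal]
  rw [ht, ht2, Finset.mul_sum]
  refine (norm_sum_le _ _).trans (Finset.sum_le_sum fun i _ => ?_)
  rw [norm_mul, Complex.norm_real, Real.norm_of_nonneg (hl0 i)]
  refine mul_le_mul_of_nonneg_right ?_ (hl0 i)
  refine (norm_entry_le _ i i).trans ?_
  have h3 := Matrix.l2_opNorm_mul (Uᴴ * u) U
  have h4 := Matrix.l2_opNorm_mul Uᴴ u
  rw [Matrix.l2_opNorm_conjTranspose] at h4
  calc _ ≤ _ := h3
    _ ≤ (1 * ‖u‖) * 1 := by gcongr; exact h4.trans (by gcongr)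
    _ = ‖u‖ := by ring

lemma norm_trace_mul_le (u x : Matrix ι ι ℂ) : ‖(u * x).trace‖ ≤ ‖u‖ * tn x := by
  obtain ⟨X, P, hP, hX, hx, -, ht⟩ := tn_polar x
  have h := norm_trace_mul_posSemidef_le (u * X) P hP
  rw [ht, Complex.ofReal_re] at h
  conv_lhs => rw [hx, ← Matrix.mul_assoc]
  refine h.trans (mul_le_mul_of_nonneg_right ?_ (tn_nonneg x))
  exact (Matrix.l2_opNorm_mul u X).trans (mul_le_of_le_one_right (norm_nonneg _) hX)

lemma tn_le_of {x : Matrix ι ι ℂ} {C : ℝ}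
    (h : ∀ u : Matrix ι ι ℂ, ‖u‖ ≤ 1 → ‖(u * x).trace‖ ≤ C) : tn x ≤ C := by
  obtain ⟨X, P, hP, hX, hx, hx2, ht⟩ := tn_polar x
  have := h Xᴴ (by rwa [Matrix.l2_opNorm_conjTranspose])
  rw [hx2, ht, Complex.norm_real, Real.norm_of_nonneg (tn_nonneg x)] at this
  exact this

lemma tn_add_le (x y : Matrix ι ι ℂ) : tn (x + y) ≤ tn x + tn y := by
  refine tn_le_of fun u hu => ?_
  rw [Matrix.mul_add, Matrix.trace_add]
  refine (norm_add_le _ _).trans (add_le_add ?_ ?_)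
  · exact (norm_trace_mul_le u x).trans (mul_le_of_le_one_left (tn_nonneg x) hu)
  · exact (norm_trace_mul_le u y).trans (mul_le_of_le_one_left (tn_nonneg y) hu)

lemma tn_zero : tn (0 : Matrix ι ι ℂ) = 0 :=
  le_antisymm (tn_le_of fun u _ => by simp) (tn_nonneg _)

lemma tn_sum_le {β : Type} (s : Finset β) (f : β → Matrix ι ι ℂ) :
    tn (∑ i ∈ s, f i) ≤ ∑ i ∈ s, tn (f i) := by
  classical
  induction s using Finset.induction_on with
  | empty => simp [tn_zero]
  | insert a s ha ih =>
    rw [Finset.sum_insert ha, Finset.sum_insert ha]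
    exact (tn_add_le _ _).trans (add_le_add le_rfl ih)

lemma tn_mul_le_left (X x : Matrix ι ι ℂ) : tn (X * x) ≤ ‖X‖ * tn x := by
  refine tn_le_of fun u hu => ?_
  rw [← Matrix.mul_assoc]
  refine (norm_trace_mul_le (u * X) x).trans (mul_le_mul_of_nonneg_right ?_ (tn_nonneg x))
  exact (Matrix.l2_opNorm_mul u X).trans (mul_le_of_le_one_left (norm_nonneg _) hu)

lemma tn_mul_le_right (X x : Matrix ι ι ℂ) : tn (x * X) ≤ ‖X‖ * tn x := by
  refine tn_le_of fun u hu => ?_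
  rw [← Matrix.mul_assoc, Matrix.trace_mul_comm, ← Matrix.mul_assoc]
  refine (norm_trace_mul_le (X * u) x).trans (mul_le_mul_of_nonneg_right ?_ (tn_nonneg x))
  exact (Matrix.l2_opNorm_mul X u).trans (mul_le_of_le_one_right (norm_nonneg _) hu)

lemma norm_kron_one_le (u : Matrix ι ι ℂ) : ‖u ⊗ₖ (1 : Matrix κ κ ℂ)‖ ≤ ‖u‖ := by
  let φ : Matrix ι ι ℂ →⋆ₐ[ℂ] Matrix (ι × κ) (ι × κ) ℂ :=
    { toFun := fun u => u ⊗ₖ (1 : Matrix κ κ ℂ)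
      map_one' := by simp
      map_mul' := fun a b => by simp [← Matrix.mul_kronecker_mul]
      map_zero' := by simp
      map_add' := fun a b => by simp [Matrix.add_kronecker]
      commutes' := fun c => by
        simp [Algebra.algebraMap_eq_smul_one, Matrix.smul_kronecker]
      map_star' := fun a => by
        simp [Matrix.star_eq_conjTranspose, Matrix.conjTranspose_kronecker] }
  exact NonUnitalStarAlgHom.norm_apply_le φ u

lemma norm_one_kron_le (u : Matrix ι ι ℂ) : ‖(1 : Matrix κ κ ℂ) ⊗ₖ u‖ ≤ ‖u‖ := by
  let φ : Matrix ι ι ℂ →⋆ₐ[ℂ] Matrix (κ × ι) (κ × ι) ℂ :=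
    { toFun := fun u => (1 : Matrix κ κ ℂ) ⊗ₖ u
      map_one' := by simp
      map_mul' := fun a b => by simp [← Matrix.mul_kronecker_mul]
      map_zero' := by simp
      map_add' := fun a b => by simp [Matrix.kronecker_add]
      commutes' := fun c => by
        simp [Algebra.algebraMap_eq_smul_one, Matrix.kronecker_smul]
      map_star' := fun a => by
        simp [Matrix.star_eq_conjTranspose, Matrix.conjTranspose_kronecker] }
  exact NonUnitalStarAlgHom.norm_apply_le φ u

lemma norm_reindex_le (e : ι ≃ κ) (u : Matrix ι ι ℂ) : ‖Matrix.reindex e e u‖ ≤ ‖u‖ := by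
  let φ : Matrix ι ι ℂ →⋆ₐ[ℂ] Matrix κ κ ℂ :=
    { Matrix.reindexAlgEquiv ℂ ℂ e with
      map_star' := fun a => by
        ext; simp
      map_one' := map_one (Matrix.reindexAlgEquiv ℂ ℂ e)
      map_zero' := map_zero (Matrix.reindexAlgEquiv ℂ ℂ e)
      commutes' := (Matrix.reindexAlgEquiv ℂ ℂ e).commutes }
  exact NonUnitalStarAlgHom.norm_apply_le φ u

lemma trace_reindex' (e : ι ≃ κ) (x : Matrix ι ι ℂ) : (Matrix.reindex e e x).trace = x.trace := by
  simp only [Matrix.trace, Matrix.diag_apply, Matrix.reindex_apply, Matrix.submatrix_apply]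
  exact e.symm.sum_comp (fun i => x i i)

lemma tn_reindex_le (e : ι ≃ κ) (x : Matrix ι ι ℂ) : tn (Matrix.reindex e e x) ≤ tn x := by
  refine tn_le_of fun u hu => ?_
  have : u * Matrix.reindex e e x
      = Matrix.reindex e e (Matrix.reindex e.symm e.symm u * x) := by
    simp [← Matrix.submatrix_mul_equiv _ _ _ e.symm]
  rw [this, trace_reindex']
  refine (norm_trace_mul_le _ _).trans ?_
  exact mul_le_of_le_one_left (tn_nonneg x) ((norm_reindex_le _ _).trans hu)

lemma tn_reindex (e : ι ≃ κ) (x : Matrix ι ι ℂ) : tn (Matrix.reindex e e x) = tn x := by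
  refine le_antisymm (tn_reindex_le e x) ?_
  have := tn_reindex_le e.symm (Matrix.reindex e e x)
  simpa using this

lemma tn_kron_le (a : Matrix ι ι ℂ) (b : Matrix κ κ ℂ) : tn (a ⊗ₖ b) ≤ tn a * tn b := by
  obtain ⟨X, P, hP, hX, hx, -, ht⟩ := tn_polar a
  obtain ⟨Y, Q, hQ, hY, hy, -, ht'⟩ := tn_polar b
  refine tn_le_of fun u hu => ?_
  have e : u * (a ⊗ₖ b) = (u * ((X ⊗ₖ 1) * (1 ⊗ₖ Y))) * (P ⊗ₖ Q) := by
    conv_lhs => rw [hx, hy]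
    rw [Matrix.mul_kronecker_mul, Matrix.mul_assoc u, ← Matrix.mul_kronecker_mul X 1,
      Matrix.one_mul, Matrix.mul_one]
  rw [e]
  have h := norm_trace_mul_posSemidef_le (u * ((X ⊗ₖ 1) * (1 ⊗ₖ Y))) _ (hP.kronecker hQ)
  rw [Matrix.trace_kronecker, ht, ht', ← Complex.ofReal_mul, Complex.ofReal_re] at h
  refine h.trans (mul_le_of_le_one_left (mul_nonneg (tn_nonneg _) (tn_nonneg _)) ?_)
  have h1 : ‖X ⊗ₖ (1 : Matrix κ κ ℂ)‖ ≤ 1 := (norm_kron_one_le X).trans hX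
  have h2 : ‖(1 : Matrix ι ι ℂ) ⊗ₖ Y‖ ≤ 1 := (norm_one_kron_le Y).trans hY
  have h3 : ‖(X ⊗ₖ (1 : Matrix κ κ ℂ)) * ((1 : Matrix ι ι ℂ) ⊗ₖ Y)‖ ≤ 1 :=
    (Matrix.l2_opNorm_mul _ _).trans (mul_le_one₀ h1 (norm_nonneg _) h2)
  exact (Matrix.l2_opNorm_mul _ _).trans (mul_le_one₀ hu (norm_nonneg _) h3)

lemma tn_posSemidef_le (P : Matrix ι ι ℂ) (hP : P.PosSemidef) : tn P ≤ P.trace.re := by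
  refine tn_le_of fun u hu => ?_
  refine (norm_trace_mul_posSemidef_le u P hP).trans ?_
  refine mul_le_of_le_one_left ?_ hu
  exact (Complex.le_def.1 hP.trace_nonneg).1

/-- Weighted partial trace over the second factor. -/
def ptr (A : Matrix ι ι ℂ) (z : Matrix (κ × ι) (κ × ι) ℂ) : Matrix κ κ ℂ :=
  Matrix.of fun i j => ∑ k, ∑ l, z (i, k) (j, l) * A l k

lemma ptr_kron (A : Matrix ι ι ℂ) (a : Matrix κ κ ℂ) (b : Matrix ι ι ℂ) :
    ptr A (a ⊗ₖ b) = (b * A).trace • a := by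
  ext i j
  simp only [ptr, Matrix.of_apply, Matrix.kroneckerMap_apply, Matrix.smul_apply, smul_eq_mul,
    Matrix.trace, Matrix.diag_apply, Matrix.mul_apply, Finset.sum_mul]
  refine Finset.sum_congr rfl fun k _ => Finset.sum_congr rfl fun l _ => by ring

lemma ptr_add (A : Matrix ι ι ℂ) (z w : Matrix (κ × ι) (κ × ι) ℂ) :
    ptr A (z + w) = ptr A z + ptr A w := by
  ext i j
  simp [ptr, add_mul, Finset.sum_add_distrib]

lemma ptr_smul (A : Matrix ι ι ℂ) (c : ℂ) (z : Matrix (κ × ι) (κ × ι) ℂ) :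
    ptr A (c • z) = c • ptr A z := by
  ext i j
  simp [ptr, Finset.mul_sum, mul_assoc]

lemma ptr_mul (A : Matrix ι ι ℂ) (B : Matrix κ κ ℂ) (z : Matrix (κ × ι) (κ × ι) ℂ) :
    ptr A z * B = ptr 1 (z * (B ⊗ₖ A)) := by
  ext i j
  simp only [ptr, Matrix.mul_apply, Matrix.of_apply, Fintype.sum_prod_type,
    Matrix.kroneckerMap_apply, Matrix.one_apply, mul_ite, mul_one, mul_zero]
  simp only [Finset.sum_ite_eq', Finset.mem_univ, if_true, Finset.sum_mul]
  rw [Finset.sum_comm]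
  refine Finset.sum_congr rfl fun k _ => Finset.sum_congr rfl fun l _ =>
    Finset.sum_congr rfl fun m _ => by ring

lemma trace_mul_ptr_one (u : Matrix κ κ ℂ) (z : Matrix (κ × ι) (κ × ι) ℂ) :
    (u * ptr 1 z).trace = ((u ⊗ₖ (1 : Matrix ι ι ℂ)) * z).trace := by
  simp only [ptr, Matrix.trace, Matrix.diag_apply, Matrix.mul_apply, Matrix.of_apply,
    Fintype.sum_prod_type, Matrix.kroneckerMap_apply, Matrix.one_apply, mul_ite, mul_one, mul_zero,
    ite_mul, zero_mul]
  simp only [Finset.sum_ite_eq', Finset.sum_ite_eq, Finset.mem_univ, if_true, Finset.mul_sum]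
  refine Finset.sum_congr rfl fun k _ => ?_
  rw [Finset.sum_comm]

lemma tn_ptr_one_le (z : Matrix (κ × ι) (κ × ι) ℂ) : tn (ptr 1 z) ≤ tn z := by
  refine tn_le_of fun u hu => ?_
  rw [trace_mul_ptr_one]
  refine (norm_trace_mul_le _ _).trans ?_
  exact mul_le_of_le_one_left (tn_nonneg z) ((norm_kron_one_le u).trans hu)

/-- Coefficient of `z` along `h`. -/
def coef (A : Matrix ι ι ℂ) (h : Matrix ι ι ℂ) (z : Matrix (κ × ι) (κ × ι) ℂ) : Matrix κ κ ℂ :=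
  ptr A (((1 : Matrix κ κ ℂ) ⊗ₖ h)ᴴ * z)

lemma coef_add (A h : Matrix ι ι ℂ) (z w : Matrix (κ × ι) (κ × ι) ℂ) :
    coef A h (z + w) = coef A h z + coef A h w := by
  simp [coef, Matrix.mul_add, ptr_add]

lemma coef_kron (A h : Matrix ι ι ℂ) (a : Matrix κ κ ℂ) (b : Matrix ι ι ℂ) :
    coef A h (a ⊗ₖ b) = ((hᴴ * b) * A).trace • a := by
  rw [coef, Matrix.conjTranspose_kronecker, ← Matrix.mul_kronecker_mul, ptr_kron]
  simp

lemma tn_coef_le (A h : Matrix ι ι ℂ) (B : Matrix κ κ ℂ) (z : Matrix (κ × ι) (κ × ι) ℂ) :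
    tn (coef A h z * B) ≤ ‖h‖ * tn (z * (B ⊗ₖ A)) := by
  rw [coef, ptr_mul]
  refine (tn_ptr_one_le _).trans ?_
  rw [Matrix.mul_assoc]
  refine (tn_mul_le_left _ _).trans (mul_le_mul_of_nonneg_right ?_ (tn_nonneg _))
  rw [Matrix.l2_opNorm_conjTranspose]
  exact norm_one_kron_le h

/-- The indicator matrix of a set of indices. -/
def indD {N : ℕ} (p : ℕ → Prop) : Matrix (Fin N) (Fin N) ℂ :=
  open Classical in Matrix.diagonal fun i => if p i then 1 else 0

lemma norm_indD_le {N : ℕ} (p : ℕ → Prop) : ‖(indD p : Matrix (Fin N) (Fin N) ℂ)‖ ≤ 1 := by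
  classical
  rw [indD, Matrix.l2_opNorm_diagonal]
  refine (pi_norm_le_iff_of_nonneg zero_le_one).2 fun i => ?_
  split_ifs <;> simp

lemma shell_lt_split (s : ℕ) : ∃ p₁ p₂ p₃ p₄ : ℕ → Prop, ∀ r c : ℕ,
    (shellNum r c < s ↔ (p₁ r ∧ p₂ c) ∨ (p₃ r ∧ p₄ c)) ∧ ¬ ((p₁ r ∧ p₂ c) ∧ (p₃ r ∧ p₄ c)) := by
  obtain ⟨k, t, hs, ht⟩ : ∃ k t, s = k * k + t ∧ t ≤ 2 * k := by
    refine ⟨Nat.sqrt s, s - Nat.sqrt s * Nat.sqrt s, ?_, ?_⟩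
    · have := Nat.sqrt_le s
      omega
    · have := Nat.sqrt_le_add s
      omega
  have h1 : ∀ a, a < k → a * a + 2 * a + 1 ≤ k * k := by
    intro a ha
    nlinarith
  have h2 : ∀ a, k < a → k * k + 2 * k + 1 ≤ a * a := by
    intro a ha
    nlinarith
  by_cases htk : t ≤ k + 1
  · refine ⟨fun r => r < k, fun c => c < k, fun r => r < t, fun c => c = k, fun r c => ?_⟩
    unfold shellNum
    split_ifs with hrc
    · rcases lt_trichotomy c k with h | h | h
      · have := h1 c h
        constructor <;> omega
      · subst h
        constructor <;> omega
      · have := h2 c h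
        constructor <;> omega
    · rcases lt_trichotomy r k with h | h | h
      · have := h1 r h
        constructor <;> omega
      · subst h
        constructor <;> omega
      · have := h2 r h
        constructor <;> omega
  · refine ⟨fun r => r < k, fun c => c ≤ k, fun r => r = k, fun c => c ≤ k ∧ 2 * k < t + c,
      fun r c => ?_⟩
    unfold shellNum
    split_ifs with hrc
    · rcases lt_trichotomy c k with h | h | h
      · have := h1 c h
        constructor <;> omega
      · subst h
        constructor <;> omega
      · have := h2 c h
        constructor <;> omega
    · rcases lt_trichotomy r k with h | h | h
      · have := h1 r h
        constructor <;> omega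
      · subst h
        constructor <;> omega
      · have := h2 r h
        constructor <;> omega

lemma shell_lt {N : ℕ} (r c : Fin N) : shellNum r c < N * N := by
  unfold shellNum
  have hr := r.2
  have hc := c.2
  split_ifs with h
  · nlinarith
  · have : (r : ℕ) * r + 2 * r + 1 ≤ N * N := by nlinarith
    omega

lemma shell_sum_apply {N : ℕ} (a : ℕ → Matrix κ κ ℂ) (s : ℕ) (p q : κ) (i j : Fin N) :
    (∑ k ∈ Finset.range s, a k ⊗ₖ eUnit N k) (p, i) (q, j)
      = if shellNum i j < s then a (shellNum i j) p q else 0 := by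
  simp [Matrix.sum_apply, eUnit]

lemma indD_comm {N : ℕ} (p : ℕ → Prop) (A : Matrix (Fin N) (Fin N) ℂ)
    (hA : ∀ i j, i ≠ j → A i j = 0) : indD p * A = A * indD p := by
  classical
  ext i j
  rw [indD, Matrix.diagonal_mul, Matrix.mul_diagonal]
  by_cases h : i = j
  · subst h; ring
  · simp [hA i j h]

lemma tn_mask_le {N : ℕ} (a : ℕ → Matrix κ κ ℂ) (B : Matrix κ κ ℂ) (A : Matrix (Fin N) (Fin N) ℂ)
    (hA : ∀ i j, i ≠ j → A i j = 0) (s : ℕ) :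
    tn ((∑ k ∈ Finset.range s, a k ⊗ₖ eUnit N k) * (B ⊗ₖ A)) ≤
      2 * tn ((∑ k ∈ Finset.range (N * N), a k ⊗ₖ eUnit N k) * (B ⊗ₖ A)) := by
  classical
  obtain ⟨p₁, p₂, p₃, p₄, hp⟩ := shell_lt_split s
  set Y := ∑ k ∈ Finset.range (N * N), a k ⊗ₖ eUnit N k with hY
  let D : (ℕ → Prop) → Matrix (κ × Fin N) (κ × Fin N) ℂ := fun p => 1 ⊗ₖ indD p
  have hDn : ∀ p, ‖D p‖ ≤ 1 := fun p => (norm_one_kron_le _).trans (norm_indD_le p)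
  have hDc : ∀ p, D p * (B ⊗ₖ A) = (B ⊗ₖ A) * D p := by
    intro p
    simp only [D]
    rw [← Matrix.mul_kronecker_mul, ← Matrix.mul_kronecker_mul, indD_comm p A hA]
    simp
  have hDd : ∀ p, D p = Matrix.diagonal (fun x : κ × Fin N => if p x.2 then (1:ℂ) else 0) := by
    intro p
    simp only [D, indD]
    rw [← Matrix.diagonal_one, Matrix.diagonal_kronecker_diagonal]
    simp
  have hsplit : ∑ k ∈ Finset.range s, a k ⊗ₖ eUnit N k = D p₁ * Y * D p₂ + D p₃ * Y * D p₄ := by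
    ext ⟨x, i⟩ ⟨y, j⟩
    rw [shell_sum_apply, Matrix.add_apply, hDd, hDd, hDd, hDd, Matrix.mul_diagonal,
      Matrix.diagonal_mul, Matrix.mul_diagonal, Matrix.diagonal_mul, hY, shell_sum_apply,
      if_pos (shell_lt i j)]
    obtain ⟨ha, hb⟩ := hp i j
    by_cases h1 : p₁ i <;> by_cases h2 : p₂ j <;> by_cases h3 : p₃ i <;> by_cases h4 : p₄ j <;>
      simp_all
  have hb : ∀ p q, tn (D p * Y * D q * (B ⊗ₖ A)) ≤ tn (Y * (B ⊗ₖ A)) := by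
    intro p q
    rw [Matrix.mul_assoc, hDc, Matrix.mul_assoc, ← Matrix.mul_assoc Y]
    refine (tn_mul_le_left _ _).trans ((mul_le_of_le_one_left (tn_nonneg _) (hDn p)).trans ?_)
    exact (tn_mul_le_right _ _).trans (mul_le_of_le_one_left (tn_nonneg _) (hDn q))
  rw [hsplit, Matrix.add_mul, two_mul]
  exact (tn_add_le _ _).trans (add_le_add (hb _ _) (hb _ _))

/-! Transfer to `Fin` indices. -/

/-- `z` viewed on the product index set. -/
def unk {n M : ℕ} (z : Matrix (Fin (n * M)) (Fin (n * M)) ℂ) :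
    Matrix (Fin n × Fin M) (Fin n × Fin M) ℂ :=
  Matrix.reindex finProdFinEquiv.symm finProdFinEquiv.symm z

/-- inverse of `unk`. -/
def rek {n M : ℕ} (z : Matrix (Fin n × Fin M) (Fin n × Fin M) ℂ) :
    Matrix (Fin (n * M)) (Fin (n * M)) ℂ :=
  Matrix.reindex finProdFinEquiv finProdFinEquiv z

lemma rek_unk {n M : ℕ} (z : Matrix (Fin (n * M)) (Fin (n * M)) ℂ) : rek (unk z) = z := by
  simp [rek, unk]

lemma rek_mul {n M : ℕ} (z w : Matrix (Fin n × Fin M) (Fin n × Fin M) ℂ) :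
    rek (z * w) = rek z * rek w := by
  simp [rek]

lemma rek_add {n M : ℕ} (z w : Matrix (Fin n × Fin M) (Fin n × Fin M) ℂ) :
    rek (z + w) = rek z + rek w := rfl

lemma rek_sum {n M : ℕ} {β : Type} (s : Finset β)
    (f : β → Matrix (Fin n × Fin M) (Fin n × Fin M) ℂ) :
    rek (∑ i ∈ s, f i) = ∑ i ∈ s, rek (f i) := by
  ext
  simp [rek, Matrix.sum_apply]

lemma rek_kron {n M : ℕ} (a : Matrix (Fin n) (Fin n) ℂ) (b : Matrix (Fin M) (Fin M) ℂ) :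
    rek (a ⊗ₖ b) = kron a b := rfl

lemma rek_conjTranspose {n M : ℕ} (z : Matrix (Fin n × Fin M) (Fin n × Fin M) ℂ) :
    rek zᴴ = (rek z)ᴴ := rfl

lemma E_eq {n M : ℕ} (A : Matrix (Fin M) (Fin M) ℂ)
    (E : Matrix (Fin (n * M)) (Fin (n * M)) ℂ →ₗ[ℂ] Matrix (Fin (n * M)) (Fin (n * M)) ℂ)
    (hE : ∀ (a : Matrix (Fin n) (Fin n) ℂ) (b : Matrix (Fin M) (Fin M) ℂ),
      E (kron a b) = (b * A).trace • kron a (1 : Matrix (Fin M) (Fin M) ℂ))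
    (z : Matrix (Fin n × Fin M) (Fin n × Fin M) ℂ) :
    E (rek z) = kron (ptr A z) 1 := by
  induction z using Matrix.induction_on' with
  | h_zero =>
    have h1 : rek (0 : Matrix (Fin n × Fin M) (Fin n × Fin M) ℂ) = 0 := by ext; simp [rek]
    have h2 : ptr A (0 : Matrix (Fin n × Fin M) (Fin n × Fin M) ℂ) = 0 := by ext; simp [ptr]
    rw [h1, h2, map_zero, ← rek_kron, Matrix.zero_kronecker, h1]
  | h_add p q hp hq =>
    rw [rek_add, map_add, hp, hq, ptr_add, ← rek_kron, ← rek_kron, ← rek_kron,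
      Matrix.add_kronecker, rek_add]
  | h_std_basis i j x =>
    have : Matrix.single i j x = Matrix.single i.1 j.1 x ⊗ₖ Matrix.single i.2 j.2 (1:ℂ) := by
      rw [Matrix.single_kronecker_single]; simp
    rw [this, rek_kron, hE, ptr_kron, ← rek_kron, ← rek_kron, Matrix.smul_kronecker]
    rfl

/-- Partial sums of the decomposition in product coordinates. -/
def psum (A : Matrix ι ι ℂ) (h : ℕ → Matrix ι ι ℂ) (z : Matrix (κ × ι) (κ × ι) ℂ) (s : ℕ) :
    Matrix (κ × ι) (κ × ι) ℂ :=
  ∑ j ∈ Finset.range s, coef A (h j) z ⊗ₖ h j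

lemma schatten_Hproj {n ν : ℕ} (α : ℝ) (r : ℕ → Matrix (Fin 2) (Fin 2) ℂ)
    (B : Matrix (Fin n) (Fin n) ℂ)
    (E : Matrix (Fin (n * 2 ^ ν)) (Fin (n * 2 ^ ν)) ℂ →ₗ[ℂ]
      Matrix (Fin (n * 2 ^ ν)) (Fin (n * 2 ^ ν)) ℂ)
    (hE : ∀ (a : Matrix (Fin n) (Fin n) ℂ) (b : Matrix (Fin (2 ^ ν)) (Fin (2 ^ ν)) ℂ),
        E (kron a b) = rho α ν b • kron a (1 : Matrix (Fin (2 ^ ν)) (Fin (2 ^ ν)) ℂ))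
    (z : Matrix (Fin n × Fin (2 ^ ν)) (Fin n × Fin (2 ^ ν)) ℂ) (s : ℕ) :
    schatten 1 ((∑ j ∈ Finset.range s, Hproj α r E j (rek z)) * kron B (Amat α ν)) =
      tn (psum (Amat α ν) (haar r ν) z s * (B ⊗ₖ Amat α ν)) := by
  have h : ∀ j, Hproj α r E j (rek z) =
      rek (coef (Amat α ν) (haar r ν j) z ⊗ₖ haar r ν j) := by
    intro j
    rw [Hproj, ← rek_kron, ← rek_conjTranspose, ← rek_mul, E_eq (Amat α ν) E hE, ← rek_kron,
      ← rek_mul, ← Matrix.mul_kronecker_mul, Matrix.one_mul, Matrix.mul_one]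
    rfl
  simp only [h]
  rw [← rek_sum, ← rek_kron, ← rek_mul, schatten_one_eq_tn]
  exact tn_reindex _ _

/-- Reassociation of the index set. -/
def asc (κ : Type) (M : ℕ) : κ × Fin (M * 2) ≃ (κ × Fin M) × Fin 2 :=
  ((Equiv.refl κ).prodCongr finProdFinEquiv.symm).trans (Equiv.prodAssoc κ (Fin M) (Fin 2)).symm

lemma asc_kron {M : ℕ} (a : Matrix κ κ ℂ) (b : Matrix (Fin M) (Fin M) ℂ)
    (c : Matrix (Fin 2) (Fin 2) ℂ) :
    Matrix.reindex (asc κ M) (asc κ M) (a ⊗ₖ kron b c) = (a ⊗ₖ b) ⊗ₖ c := by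
  ext ⟨⟨i, j⟩, k⟩ ⟨⟨i', j'⟩, k'⟩
  simp [asc, kron, mul_assoc]

lemma ptr_asc {M : ℕ} (A : Matrix (Fin M) (Fin M) ℂ) (A' : Matrix (Fin 2) (Fin 2) ℂ)
    (z : Matrix (κ × Fin (M * 2)) (κ × Fin (M * 2)) ℂ) :
    ptr (kron A A') z = ptr A (ptr A' (Matrix.reindex (asc κ M) (asc κ M) z)) := by
  ext i j
  simp only [ptr, Matrix.of_apply]
  rw [← finProdFinEquiv.sum_comp]
  simp only [← finProdFinEquiv.sum_comp (fun l : Fin (M * 2) => z _ (j, l) * kron A A' l _)]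
  simp only [Fintype.sum_prod_type, kron, asc, Matrix.reindex_apply, Matrix.submatrix_apply,
    Equiv.symm_apply_apply, Matrix.kroneckerMap_apply, Finset.sum_mul]
  refine Finset.sum_congr rfl fun k _ => ?_
  rw [Finset.sum_comm]
  refine Finset.sum_congr rfl fun l _ => Finset.sum_congr rfl fun m _ =>
    Finset.sum_congr rfl fun o _ => ?_
  simp only [Equiv.symm_trans_apply, Equiv.symm_symm, Equiv.prodAssoc_apply,
    Equiv.prodCongr_symm, Equiv.prodCongr_apply, Prod.map, Equiv.refl_symm, Equiv.refl_apply]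
  ring

lemma mul_ptr (A : Matrix ι ι ℂ) (u : Matrix κ κ ℂ) (z : Matrix (κ × ι) (κ × ι) ℂ) :
    u * ptr A z = ptr A ((u ⊗ₖ (1 : Matrix ι ι ℂ)) * z) := by
  ext i j
  simp only [ptr, Matrix.mul_apply, Matrix.of_apply, Fintype.sum_prod_type,
    Matrix.kroneckerMap_apply, Matrix.one_apply, mul_ite, mul_one, mul_zero, ite_mul, zero_mul]
  simp only [Finset.sum_ite_eq, Finset.mem_univ, if_true, Finset.sum_mul, Finset.mul_sum]
  rw [Finset.sum_comm]
  refine Finset.sum_congr rfl fun k _ => ?_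
  rw [Finset.sum_comm]
  refine Finset.sum_congr rfl fun l _ => Finset.sum_congr rfl fun m _ => by ring

lemma coef_asc {M : ℕ} (A h : Matrix (Fin M) (Fin M) ℂ) (A' r : Matrix (Fin 2) (Fin 2) ℂ)
    (z : Matrix (κ × Fin (M * 2)) (κ × Fin (M * 2)) ℂ) :
    coef (kron A A') (kron h r) z =
      coef A h (coef A' r (Matrix.reindex (asc κ M) (asc κ M) z)) := by
  rw [coef, coef, coef, ptr_asc, mul_ptr, ← Matrix.mul_assoc]
  congr 2
  have : Matrix.reindex (asc κ M) (asc κ M) (((1 : Matrix κ κ ℂ) ⊗ₖ kron h r)ᴴ * z)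
      = (Matrix.reindex (asc κ M) (asc κ M) ((1 : Matrix κ κ ℂ) ⊗ₖ kron h r))ᴴ *
        Matrix.reindex (asc κ M) (asc κ M) z := by
    simp
  rw [this, asc_kron]
  congr 1
  rw [Matrix.conjTranspose_kronecker _ r, Matrix.conjTranspose_kronecker _ r,
    ← Matrix.mul_kronecker_mul]
  simp

lemma Amat_offdiag (α : ℝ) (ν : ℕ) : ∀ i j, i ≠ j → Amat α ν i j = 0 := by
  induction ν with
  | zero => intro i j h; exact Matrix.one_apply_ne h
  | succ ν ih =>
    intro i j h
    obtain ⟨⟨a, b⟩, rfl⟩ := (finProdFinEquiv (m := 2 ^ ν) (n := 2)).surjective i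
    obtain ⟨⟨c, d⟩, rfl⟩ := (finProdFinEquiv (m := 2 ^ ν) (n := 2)).surjective j
    have e : Amat α (ν + 1) (finProdFinEquiv (a, b)) (finProdFinEquiv (c, d))
        = Amat α ν a c * A1 α b d := by
      simp [Amat, kron]
    rw [e]
    by_cases hac : a = c
    · have hbd : b ≠ d := by
        rintro rfl
        exact h (by rw [hac])
      rw [A1, Matrix.diagonal_apply_ne _ hbd, mul_zero]
    · rw [ih a c hac, zero_mul]

lemma Amat_one (α : ℝ) : Amat α 1 = A1 α := by
  have key : ∀ a b : Fin 2, kron (1 : Matrix (Fin 1) (Fin 1) ℂ) (A1 α)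
      (finProdFinEquiv ((0 : Fin 1), a)) (finProdFinEquiv ((0 : Fin 1), b)) = A1 α a b := by
    intro a b
    simp [kron]
  have e : ∀ a : Fin 2, (finProdFinEquiv ((0 : Fin 1), a) : Fin (1 * 2)) = (a : Fin 2) := by
    intro a
    fin_cases a <;> rfl
  ext a b
  have := key a b
  rw [e, e] at this
  exact this

lemma tn_A1_le (α : ℝ) (h0 : 0 < α) (h1 : α ≤ 1 / 2) : tn (A1 α) ≤ 1 := by
  have hP : (A1 α).PosSemidef := by
    refine Matrix.PosSemidef.diagonal ?_
    intro i
    have h2 : (0 : ℝ) ≤ 1 - α := by linarith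
    fin_cases i
    · exact Complex.zero_le_real.2 h0.le
    · exact Complex.zero_le_real.2 h2
  refine (tn_posSemidef_le _ hP).trans ?_
  simp [A1, Matrix.trace]

lemma coef_sum_kron (A : Matrix ι ι ℂ) (r : ℕ → Matrix ι ι ℂ)
    (hr : ∀ j < 4, ∀ k < 4, ((r j)ᴴ * r k * A).trace = if j = k then 1 else 0)
    (y : ℕ → Matrix κ κ ℂ) (q : ℕ) (hq : q < 4) :
    coef A (r q) (∑ k ∈ Finset.range 4, y k ⊗ₖ r k) = y q := by
  have h : ∀ k, k < 4 → coef A (r q) (y k ⊗ₖ r k) = (if q = k then (1:ℂ) else 0) • y k := by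
    intro k hk
    rw [coef_kron, hr q hq k hk]
  simp only [Finset.sum_range_succ, Finset.sum_range_zero, zero_add, coef_add]
  rw [h 0 (by norm_num), h 1 (by norm_num), h 2 (by norm_num), h 3 (by norm_num)]
  interval_cases q <;> simp

lemma part_one (A : Matrix ι ι ℂ) (r : ℕ → Matrix ι ι ℂ)
    (hr : ∀ j < 4, ∀ k < 4, ((r j)ᴴ * r k * A).trace = if j = k then 1 else 0)
    (B : Matrix κ κ ℂ) (z : Matrix (κ × ι) (κ × ι) ℂ) (m : ℕ) (hm : m < 4) :
    tn (psum A r z (m + 1) * (B ⊗ₖ A)) ≤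
      (∑ j ∈ Finset.range 4, ‖r j‖ * tn (r j * A)) * tn (psum A r z 4 * (B ⊗ₖ A)) := by
  rw [psum, Finset.sum_mul]
  refine (tn_sum_le _ _).trans ?_
  rw [Finset.sum_mul]
  have hb : ∀ j < 4, tn (coef A (r j) z ⊗ₖ r j * (B ⊗ₖ A)) ≤
      ‖r j‖ * tn (r j * A) * tn (psum A r z 4 * (B ⊗ₖ A)) := by
    intro j hj
    rw [← Matrix.mul_kronecker_mul]
    refine (tn_kron_le _ _).trans ?_
    have h1 := tn_coef_le A (r j) B (psum A r z 4)
    rw [psum, coef_sum_kron A r hr _ j hj] at h1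
    calc _ ≤ _ := mul_le_mul_of_nonneg_right h1 (tn_nonneg _)
      _ = _ := by rw [psum]; ring
  refine (Finset.sum_le_sum fun j hj => hb j ?_).trans ?_
  · have := Finset.mem_range.1 hj
    omega
  · refine Finset.sum_le_sum_of_subset_of_nonneg ?_ fun j _ _ => ?_
    · intro j hj
      have := Finset.mem_range.1 hj
      exact Finset.mem_range.2 (by omega)
    · exact mul_nonneg (mul_nonneg (norm_nonneg _) (tn_nonneg _)) (tn_nonneg _)

/-- Blocks of the Haar system. -/
def hblock (r : ℕ → Matrix (Fin 2) (Fin 2) ℂ) (ν q : ℕ) : ℕ → Matrix (Fin (2 ^ ν)) (Fin (2 ^ ν)) ℂ :=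
  if q = 0 then haar r ν else eUnit (2 ^ ν)

lemma haar_block (r : ℕ → Matrix (Fin 2) (Fin 2) ℂ) (ν : ℕ) (hν : 1 ≤ ν) (q k : ℕ) (hq : q < 4)
    (hk : k < 4 ^ ν) :
    haar r (ν + 1) (4 ^ ν * q + k) = kron (hblock r ν q k) (r q) := by
  obtain ⟨μ, rfl⟩ : ∃ μ, ν = μ + 1 := ⟨ν - 1, by omega⟩
  have hpos : 0 < 4 ^ (μ + 1) := by positivity
  have hd : (4 ^ (μ + 1) * q + k) / 4 ^ (μ + 1) = q := by
    rw [Nat.mul_add_div hpos, Nat.div_eq_of_lt hk, add_zero]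
  have hm : (4 ^ (μ + 1) * q + k) % 4 ^ (μ + 1) = k := by
    rw [Nat.mul_add_mod, Nat.mod_eq_of_lt hk]
  rw [haar, hd, hm, hblock]
  by_cases h : q = 0
  · subst h
    simp only [if_true, Nat.mul_zero, Nat.zero_add]
    rfl
  · simp only [if_neg h, Nat.mod_eq_of_lt hq]
    exact if_neg h

lemma part_two (α : ℝ) (hα0 : 0 < α) (hα : α ≤ 1 / 2) (B : Matrix κ κ ℂ)
    (r : ℕ → Matrix (Fin 2) (Fin 2) ℂ)
    (hr : ∀ j < 4, ∀ k < 4, ((r j)ᴴ * r k * A1 α).trace = if j = k then 1 else 0)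
    (ν : ℕ) (hν : 1 ≤ ν) (c : ℝ) (hc0 : 0 ≤ c)
    (hc : ∀ m < 4 ^ ν, ∀ z : Matrix (κ × Fin (2 ^ ν)) (κ × Fin (2 ^ ν)) ℂ,
      tn (psum (Amat α ν) (haar r ν) z (m + 1) * (B ⊗ₖ Amat α ν)) ≤
        c * tn (psum (Amat α ν) (haar r ν) z (4 ^ ν) * (B ⊗ₖ Amat α ν)))
    (m : ℕ) (hm : m < 4 ^ (ν + 1))
    (z : Matrix (κ × Fin (2 ^ (ν + 1))) (κ × Fin (2 ^ (ν + 1))) ℂ) :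
    tn (psum (Amat α (ν + 1)) (haar r (ν + 1)) z (m + 1) * (B ⊗ₖ Amat α (ν + 1))) ≤
      max (c * ‖r 0‖ ^ 2) (‖r 0‖ ^ 2 + 2 * (‖r 1‖ ^ 2 + ‖r 2‖ ^ 2 + ‖r 3‖ ^ 2)) *
      tn (psum (Amat α (ν + 1)) (haar r (ν + 1)) z (4 ^ (ν + 1)) * (B ⊗ₖ Amat α (ν + 1))) := by
  set K := 4 ^ ν with hK
  have hKpos : 0 < K := by positivity
  have hK4 : 4 ^ (ν + 1) = K * 4 := pow_succ 4 ν
  have hKN : K = 2 ^ ν * 2 ^ ν := by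
    rw [hK, ← mul_pow]; norm_num
  let z' : Matrix ((κ × Fin (2 ^ ν)) × Fin 2) ((κ × Fin (2 ^ ν)) × Fin 2) ℂ :=
    Matrix.reindex (asc κ (2 ^ ν)) (asc κ (2 ^ ν)) z
  let zq : ℕ → Matrix (κ × Fin (2 ^ ν)) (κ × Fin (2 ^ ν)) ℂ := fun q => coef (A1 α) (r q) z'
  let y : ℕ → ℕ → Matrix (κ × Fin (2 ^ ν)) (κ × Fin (2 ^ ν)) ℂ :=
    fun q s => psum (Amat α ν) (hblock r ν q) (zq q) s
  let B' := B ⊗ₖ Amat α ν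
  let f : ℕ → Matrix ((κ × Fin (2 ^ ν)) × Fin 2) ((κ × Fin (2 ^ ν)) × Fin 2) ℂ := fun j =>
    Matrix.reindex (asc κ (2 ^ ν)) (asc κ (2 ^ ν))
      (coef (Amat α (ν + 1)) (haar r (ν + 1) j) z ⊗ₖ haar r (ν + 1) j)
  have hf : ∀ q k, q < 4 → k < K → f (K * q + k) =
      (coef (Amat α ν) (hblock r ν q k) (zq q) ⊗ₖ hblock r ν q k) ⊗ₖ r q := by
    intro q k hq hk
    simp only [f, zq, z']
    rw [haar_block r ν hν q k hq hk]
    have e1 := coef_asc (κ := κ) (Amat α ν) (hblock r ν q k) (A1 α) (r q) z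
    refine (asc_kron _ _ _).trans ?_
    rw [← e1]
    rfl
  have hfs : ∀ q s, q < 4 → s ≤ K → ∑ k ∈ Finset.range s, f (K * q + k) = y q s ⊗ₖ r q := by
    intro q s hq hs
    simp only [y, psum]
    have : ∀ (t : Finset ℕ) (g : ℕ → Matrix (κ × Fin (2 ^ ν)) (κ × Fin (2 ^ ν)) ℂ),
        (∑ k ∈ t, g k) ⊗ₖ r q = ∑ k ∈ t, (g k ⊗ₖ r q) := by
      intro t g
      ext i j
      simp [Matrix.sum_apply, Finset.sum_mul]
    rw [this]
    refine Finset.sum_congr rfl fun k hk => hf q k hq ?_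
    have := Finset.mem_range.1 hk
    omega
  have htn : ∀ s, tn (psum (Amat α (ν + 1)) (haar r (ν + 1)) z s * (B ⊗ₖ Amat α (ν + 1))) =
      tn ((∑ j ∈ Finset.range s, f j) * (B' ⊗ₖ A1 α)) := by
    intro s
    refine (tn_reindex (asc κ (2 ^ ν)) _).symm.trans ?_
    congr 1
    have e1 : Matrix.reindex (asc κ (2 ^ ν)) (asc κ (2 ^ ν)) (B ⊗ₖ Amat α (ν + 1)) = B' ⊗ₖ A1 α :=
      asc_kron _ _ _
    have e2 : Matrix.reindex (asc κ (2 ^ ν)) (asc κ (2 ^ ν))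
        (psum (Amat α (ν + 1)) (haar r (ν + 1)) z s) = ∑ j ∈ Finset.range s, f j := by
      ext i j
      simp [psum, f, Matrix.sum_apply]
      rfl
    rw [← e1, ← e2]
    exact (Matrix.submatrix_mul_equiv _ _ _ _ _).symm
  have hblk : ∀ q s, q < 4 → s ≤ K → ∑ j ∈ Finset.range (K * q + s), f j =
      ∑ q' ∈ Finset.range q, y q' K ⊗ₖ r q' + y q s ⊗ₖ r q := by
    intro q
    induction q with
    | zero =>
      intro s hq hs
      have := hfs 0 s hq hs
      simpa using this
    | succ q ih =>
      intro s hq hs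
      rw [Finset.sum_range_add, hfs (q + 1) s hq hs, Nat.mul_succ, ih K (by omega) le_rfl,
        Finset.sum_range_succ]
  have hfull : ∑ j ∈ Finset.range (4 ^ (ν + 1)), f j =
      ∑ q ∈ Finset.range 4, y q K ⊗ₖ r q := by
    have := hblk 3 K (by norm_num) le_rfl
    rw [hK4, show K * 4 = K * 3 + K by ring, this, Finset.sum_range_succ _ 3]
  rw [htn, htn, hfull]
  set W := tn ((∑ q ∈ Finset.range 4, y q K ⊗ₖ r q) * (B' ⊗ₖ A1 α)) with hW
  have hW0 : 0 ≤ W := tn_nonneg _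
  have hyq : ∀ q < 4, tn (y q K * B') ≤ ‖r q‖ * W := by
    intro q hq
    have := tn_coef_le (A1 α) (r q) B' (∑ q ∈ Finset.range 4, y q K ⊗ₖ r q)
    rwa [coef_sum_kron (A1 α) r hr (fun q => y q K) q hq] at this
  have hten : ∀ q (x : Matrix (κ × Fin (2 ^ ν)) (κ × Fin (2 ^ ν)) ℂ),
      tn (x ⊗ₖ r q * (B' ⊗ₖ A1 α)) ≤ ‖r q‖ * tn (x * B') := by
    intro q x
    rw [← Matrix.mul_kronecker_mul]
    refine (tn_kron_le _ _).trans ?_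
    rw [mul_comm]
    refine mul_le_mul_of_nonneg_right ?_ (tn_nonneg _)
    exact (tn_mul_le_left _ _).trans
      (mul_le_of_le_one_right (norm_nonneg _) (tn_A1_le α hα0 hα))
  have hfullq : ∀ q < 4, tn (y q K ⊗ₖ r q * (B' ⊗ₖ A1 α)) ≤ ‖r q‖ ^ 2 * W := by
    intro q hq
    refine (hten q _).trans ?_
    calc _ ≤ ‖r q‖ * (‖r q‖ * W) := mul_le_mul_of_nonneg_left (hyq q hq) (norm_nonneg _)
      _ = _ := by ring
  have hpart : ∀ q < 4, q ≠ 0 → ∀ s, tn (y q s ⊗ₖ r q * (B' ⊗ₖ A1 α)) ≤ 2 * ‖r q‖ ^ 2 * W := by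
    intro q hq hq0 s
    refine (hten q _).trans ?_
    have h1 : tn (y q s * B') ≤ 2 * tn (y q K * B') := by
      simp only [y, psum, hblock, if_neg hq0]
      rw [hKN]
      exact tn_mask_le (fun k => coef (Amat α ν) (eUnit (2 ^ ν) k) (zq q)) B (Amat α ν)
        (Amat_offdiag α ν) s
    have h2 := hyq q hq
    calc _ ≤ ‖r q‖ * (2 * (‖r q‖ * W)) :=
          mul_le_mul_of_nonneg_left (h1.trans (by linarith)) (norm_nonneg _)
      _ = _ := by ring
  have hpart0 : ∀ s < K, tn (y 0 (s + 1) ⊗ₖ r 0 * (B' ⊗ₖ A1 α)) ≤ c * ‖r 0‖ ^ 2 * W := by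
    intro s hs
    refine (hten 0 _).trans ?_
    have h1 : tn (y 0 (s + 1) * B') ≤ c * tn (y 0 K * B') := by
      simp only [y, hblock, if_true]
      exact hc s hs (zq 0)
    have h2 := mul_le_mul_of_nonneg_left (hyq 0 (by norm_num)) hc0
    calc _ ≤ ‖r 0‖ * (c * (‖r 0‖ * W)) :=
          mul_le_mul_of_nonneg_left (h1.trans h2) (norm_nonneg _)
      _ = _ := by ring
  have hmd : m + 1 = K * (m / K) + (m % K + 1) := by
    have := Nat.div_add_mod m K
    omega
  have hmk : m % K < K := Nat.mod_lt _ hKpos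
  have hq4 : m / K < 4 := by
    rw [Nat.div_lt_iff_lt_mul hKpos]
    omega
  rw [hmd, hblk (m / K) (m % K + 1) hq4 hmk]
  have n0 : 0 ≤ ‖r 0‖ ^ 2 * W := by positivity
  have n1 : 0 ≤ ‖r 1‖ ^ 2 * W := by positivity
  have n2 : 0 ≤ ‖r 2‖ ^ 2 * W := by positivity
  have n3 : 0 ≤ ‖r 3‖ ^ 2 * W := by positivity
  have f0 := hfullq 0 (by norm_num)
  have f1 := hfullq 1 (by norm_num)
  have f2 := hfullq 2 (by norm_num)
  have p1 := hpart 1 (by norm_num) (by norm_num) (m % K + 1)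
  have p2 := hpart 2 (by norm_num) (by norm_num) (m % K + 1)
  have p3 := hpart 3 (by norm_num) (by norm_num) (m % K + 1)
  have p0 := hpart0 (m % K) hmk
  generalize m / K = q at *
  rw [Matrix.add_mul]
  by_cases hq0 : q = 0
  · subst hq0
    simp only [Finset.range_zero, Finset.sum_empty, Matrix.zero_mul, zero_add]
    exact p0.trans (mul_le_mul_of_nonneg_right (le_max_left _ _) hW0)
  · refine le_trans ?_ (mul_le_mul_of_nonneg_right (le_max_right _ _) hW0)
    refine (tn_add_le _ _).trans ?_
    rw [Finset.sum_mul]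
    have hs := tn_sum_le (Finset.range q) (fun q' => y q' K ⊗ₖ r q' * (B' ⊗ₖ A1 α))
    interval_cases q
    · exact absurd rfl hq0
    · simp only [Finset.sum_range_succ, Finset.sum_range_zero, zero_add] at hs ⊢
      linarith
    · simp only [Finset.sum_range_succ, Finset.sum_range_zero, zero_add] at hs ⊢
      linarith
    · simp only [Finset.sum_range_succ, Finset.sum_range_zero, zero_add] at hs ⊢
      linarith

end Helpers

/-- for the Schauder decomposition `H^{(ν)}` of `(M_n(ℂ) ⊗ N_ν, ‖·‖_♯)`,
`‖z‖_♯ = ‖z (B ⊗ A_ν)‖_{C_1}`, the minimal constants satisfy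
`c_1 ≤ Σ_j ‖r_j‖ ‖r_j‖_♯` and `c_{ν+1} ≤ max{c_ν ‖r_0‖², ‖r_0‖² + 2 Σ_{q=1}^3 ‖r_q‖²}`. -/
theorem tensor_haar_decomposition_constants
    (α : ℝ) (hα0 : 0 < α) (hα : α ≤ 1 / 2)
    (n : ℕ) (hn : 1 ≤ n)
    (B : Matrix (Fin n) (Fin n) ℂ) (hB : B.PosDef) (hTrB : B.trace = 1)
    (r : ℕ → Matrix (Fin 2) (Fin 2) ℂ)
    (hr : ∀ j < 4, ∀ k < 4, rho1 α ((r j)ᴴ * r k) = if j = k then 1 else 0) :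
    (∀ E : Matrix (Fin (n * 2 ^ 1)) (Fin (n * 2 ^ 1)) ℂ →ₗ[ℂ]
        Matrix (Fin (n * 2 ^ 1)) (Fin (n * 2 ^ 1)) ℂ,
      (∀ (a : Matrix (Fin n) (Fin n) ℂ) (b : Matrix (Fin (2 ^ 1)) (Fin (2 ^ 1)) ℂ),
        E (kron a b) = rho α 1 b • kron a (1 : Matrix (Fin (2 ^ 1)) (Fin (2 ^ 1)) ℂ)) →
      ∀ m < 4, ∀ z,
        schatten 1 ((∑ j ∈ Finset.range (m + 1), Hproj α r E j z) * kron B (Amat α 1)) ≤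
          (∑ j ∈ Finset.range 4, opNorm (r j) * sharp2 α (r j)) *
            schatten 1 ((∑ j ∈ Finset.range 4, Hproj α r E j z) * kron B (Amat α 1))) ∧
    (∀ ν, 1 ≤ ν →
      ∀ E : Matrix (Fin (n * 2 ^ ν)) (Fin (n * 2 ^ ν)) ℂ →ₗ[ℂ]
        Matrix (Fin (n * 2 ^ ν)) (Fin (n * 2 ^ ν)) ℂ,
      ∀ E' : Matrix (Fin (n * 2 ^ (ν + 1))) (Fin (n * 2 ^ (ν + 1))) ℂ →ₗ[ℂ]
        Matrix (Fin (n * 2 ^ (ν + 1))) (Fin (n * 2 ^ (ν + 1))) ℂ,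
      (∀ (a : Matrix (Fin n) (Fin n) ℂ) (b : Matrix (Fin (2 ^ ν)) (Fin (2 ^ ν)) ℂ),
        E (kron a b) = rho α ν b • kron a (1 : Matrix (Fin (2 ^ ν)) (Fin (2 ^ ν)) ℂ)) →
      (∀ (a : Matrix (Fin n) (Fin n) ℂ)
          (b : Matrix (Fin (2 ^ (ν + 1))) (Fin (2 ^ (ν + 1))) ℂ),
        E' (kron a b) =
          rho α (ν + 1) b • kron a (1 : Matrix (Fin (2 ^ (ν + 1))) (Fin (2 ^ (ν + 1))) ℂ)) →
      ∀ c : ℝ, 0 ≤ c →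
      (∀ m < 4 ^ ν, ∀ z,
        schatten 1 ((∑ j ∈ Finset.range (m + 1), Hproj α r E j z) * kron B (Amat α ν)) ≤
          c * schatten 1
            ((∑ j ∈ Finset.range (4 ^ ν), Hproj α r E j z) * kron B (Amat α ν))) →
      ∀ m < 4 ^ (ν + 1), ∀ z,
        schatten 1
            ((∑ j ∈ Finset.range (m + 1), Hproj α r E' j z) * kron B (Amat α (ν + 1))) ≤
          max (c * opNorm (r 0) ^ 2)
              (opNorm (r 0) ^ 2 +
                2 * (opNorm (r 1) ^ 2 + opNorm (r 2) ^ 2 + opNorm (r 3) ^ 2)) *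
            schatten 1
              ((∑ j ∈ Finset.range (4 ^ (ν + 1)), Hproj α r E' j z) *
                kron B (Amat α (ν + 1)))) := by
  refine ⟨?_, ?_⟩
  · intro E hE m hm z
    rw [← rek_unk z, schatten_Hproj α r B E hE, schatten_Hproj α r B E hE]
    have hr' : ∀ j < 4, ∀ k < 4, ((haar r 1 j)ᴴ * haar r 1 k * Amat α 1).trace
        = if j = k then 1 else 0 := by
      intro j hj k hk
      have := hr j hj k hk
      rw [rho1] at this
      rw [Amat_one, haar, haar, Nat.mod_eq_of_lt hj, Nat.mod_eq_of_lt hk]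
      exact this
    have h := part_one (Amat α 1) (haar r 1) hr' B (unk z) m hm
    have hs : ∑ j ∈ Finset.range 4, opNorm (r j) * sharp2 α (r j)
        = ∑ j ∈ Finset.range 4, opNorm (haar r 1 j) * tn (haar r 1 j * Amat α 1) := by
      refine Finset.sum_congr rfl fun j hj => ?_
      rw [sharp2, schatten_one_eq_tn, Amat_one, haar, Nat.mod_eq_of_lt (Finset.mem_range.1 hj)]
    rw [hs]
    exact h
  · intro ν hν E E' hE hE' c hc0 hc m hm z
    rw [← rek_unk z, schatten_Hproj α r B E' hE', schatten_Hproj α r B E' hE']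
    refine part_two α hα0 hα B r (fun j hj k hk => hr j hj k hk) ν hν c hc0 ?_ m hm (unk z)
    intro m hm z
    have := hc m hm (rek z)
    rwa [schatten_Hproj α r B E hE, schatten_Hproj α r B E hE] at this

end
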